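/- arXiv:2003.12429 — 8 statements merged into one kernel-verified Lean document; each statement's English description precedes it below -/
import Mathlib

section
/- Let q be a prime power, F a finite field with q elements, 1 ≤ k ≤ n−1. If 𝓛 is a Cameron–Liebler k-set of AG(n,q), then 𝓛, viewed as a set of projective k-spaces, is a Cameron–Liebler k-set of PG(n,q) with the same cardinality (hence the same parameter). -/
open Module

/-- The Gaussian binomial coefficient `[a b]_q`. -/
noncomputable def gaussBinom (q a b : ℕ) : ℚ :=
  ∏ i ∈ Finset.range b, ((q : ℚ) ^ (a - i) - 1) / ((q : ℚ) ^ (i + 1) - 1)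

variable {F : Type} [Field F] [Fintype F] {n : ℕ}

/-- `K` is a projective `j`-space of `PG(n,q)`: a submodule of rank `j+1`. -/
def IsProjSub (j : ℕ) (K : Submodule F (Fin (n + 1) → F)) : Prop :=
  Module.finrank F K = j + 1

/-- `P` is a projective point: a submodule of rank `1`. -/
def IsProjPoint (P : Submodule F (Fin (n + 1) → F)) : Prop :=
  Module.finrank F P = 1

/-- `P` is an affine point w.r.t. the hyperplane at infinity `Hinf`. -/
def IsAffPoint (Hinf P : Submodule F (Fin (n + 1) → F)) : Prop :=
  Module.finrank F P = 1 ∧ ¬ P ≤ Hinf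

/-- `K` is an affine `j`-space (a `j`-space of `AG(n,q)`). -/
def IsAffSub (j : ℕ) (Hinf K : Submodule F (Fin (n + 1) → F)) : Prop :=
  Module.finrank F K = j + 1 ∧ ¬ K ≤ Hinf

/-- `M` is a Cameron–Liebler `k`-set of `PG(n,q)`. -/
def IsCLProj (k : ℕ) (M : Set (Submodule F (Fin (n + 1) → F))) : Prop :=
  (∀ K ∈ M, IsProjSub k K) ∧
  ∃ w : Submodule F (Fin (n + 1) → F) → ℝ,
    ∀ K, IsProjSub k K →
      Set.indicator M (fun _ => (1 : ℝ)) K =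
        ∑ᶠ P ∈ {P | IsProjPoint P ∧ P ≤ K}, w P

/-- `L` is a Cameron–Liebler `k`-set of `AG(n,q)`. -/
def IsCLAff (k : ℕ) (Hinf : Submodule F (Fin (n + 1) → F))
    (L : Set (Submodule F (Fin (n + 1) → F))) : Prop :=
  (∀ K ∈ L, IsAffSub k Hinf K) ∧
  ∃ w : Submodule F (Fin (n + 1) → F) → ℝ,
    ∀ K, IsAffSub k Hinf K →
      Set.indicator L (fun _ => (1 : ℝ)) K =
        ∑ᶠ P ∈ {P | IsAffPoint Hinf P ∧ P ≤ K}, w P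

/-- `S` is a `k`-spread of `AG(n,q)`: every affine point is on exactly one member. -/
def IsSpread (k : ℕ) (Hinf : Submodule F (Fin (n + 1) → F))
    (S : Set (Submodule F (Fin (n + 1) → F))) : Prop :=
  (∀ K ∈ S, IsAffSub k Hinf K) ∧
  ∀ P, IsAffPoint Hinf P → ∃! K, K ∈ S ∧ P ≤ K


theorem statement1 (q k : ℕ) (hq : IsPrimePow q) (hF : Fintype.card F = q)
    (hk : 1 ≤ k) (hkn : k ≤ n - 1)
    (Hinf : Submodule F (Fin (n + 1) → F)) (hH : Module.finrank F Hinf = n)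
    (L : Set (Submodule F (Fin (n + 1) → F)))
    (hL : IsCLAff k Hinf L) :
    IsCLProj k L := by
  classical
  obtain ⟨hsub, w, hw⟩ := hL
  -- Extend the affine weight by zero to the points at infinity.
  refine ⟨fun K hK => (hsub K hK).1, fun P => if P ≤ Hinf then 0 else w P, fun K hK => ?_⟩
  by_cases hKH : K ≤ Hinf
  · rw [Set.indicator_of_notMem fun hKL => (hsub K hKL).2 hKH]
    exact (finsum_mem_eq_zero_of_forall_eq_zero fun P hP =>
      if_pos (le_trans hP.2 hKH)).symm
  · rw [hw K ⟨hK, hKH⟩, finsum_mem_def, finsum_mem_def]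
    refine finsum_congr fun P => ?_
    simp only [Set.indicator_apply, Set.mem_ofPred_eq, IsAffPoint, IsProjPoint]
    by_cases hP : P ≤ Hinf <;> simp [hP]
end

section
/- Let q be a prime power, F a finite field with q elements, 1 ≤ k ≤ n−1, and let W ≤ H∞ be a submodule with finrank W = n−1 (an (n−2)-space at infinity). Suppose that to every submodule π of V with finrank π = n, W ≤ π and π ≠ H∞ (a hyperplane through W other than H∞) we assign a submodule τ(π) ≤ W with finrank τ(π) = k (a (k−1)-space in W). Then the set S of all affine k-spaces K for which there exists such a hyperplane π with τ(π) ≤ K and K ≤ π is a k-spread of AG(n,q) (a spread of type III). -/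
open Module

variable {F : Type} [Field F] [Fintype F] {n : ℕ}

/-- Joining a subspace with a line not contained in it raises the rank by one. -/
theorem Submodule.finrank_sup_eq_succ_of_finrank_eq_one {K V : Type*} [DivisionRing K]
    [AddCommGroup V] [Module K V] [FiniteDimensional K V] {X P : Submodule K V}
    (hP : finrank K P = 1) (h : ¬ P ≤ X) : finrank K ↥(X ⊔ P) = finrank K X + 1 := by
  have hinf : finrank K ↥(X ⊓ P) < finrank K P :=
    Submodule.finrank_lt_finrank_of_lt (inf_le_right.lt_of_ne fun he => h (inf_eq_right.mp he))
  have := Submodule.finrank_sup_add_finrank_inf_eq X P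
  omega

theorem statement2 (q k : ℕ) (hq : IsPrimePow q) (hF : Fintype.card F = q)
    (hk : 1 ≤ k) (hkn : k ≤ n - 1)
    (Hinf : Submodule F (Fin (n + 1) → F)) (hH : Module.finrank F Hinf = n)
    (W : Submodule F (Fin (n + 1) → F)) (hW : W ≤ Hinf)
    (hWr : Module.finrank F W = n - 1)
    (τ : Submodule F (Fin (n + 1) → F) → Submodule F (Fin (n + 1) → F))
    (hτ : ∀ π : Submodule F (Fin (n + 1) → F), Module.finrank F π = n → W ≤ π → π ≠ Hinf →
      τ π ≤ W ∧ Module.finrank F (τ π) = k) :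
    IsSpread k Hinf {K | IsAffSub k Hinf K ∧
      ∃ π : Submodule F (Fin (n + 1) → F), Module.finrank F π = n ∧ W ≤ π ∧ π ≠ Hinf ∧ τ π ≤ K ∧ K ≤ π} := by
  refine ⟨fun K hK => hK.1, ?_⟩
  rintro P ⟨hP, hPH⟩
  have hrank : finrank F ↥(W ⊔ P) = n := by
    rw [Submodule.finrank_sup_eq_succ_of_finrank_eq_one hP fun h => hPH (h.trans hW)]
    omega
  have hne : W ⊔ P ≠ Hinf := fun h => hPH (h ▸ le_sup_right)
  obtain ⟨hτW, hτr⟩ := hτ (W ⊔ P) hrank le_sup_left hne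
  have hKr : finrank F ↥(τ (W ⊔ P) ⊔ P) = k + 1 := by
    rw [Submodule.finrank_sup_eq_succ_of_finrank_eq_one hP
      fun h => hPH (h.trans (hτW.trans hW)), hτr]
  refine ⟨τ (W ⊔ P) ⊔ P, ⟨⟨⟨hKr, fun h => hPH (le_sup_right.trans h)⟩, W ⊔ P, hrank,
    le_sup_left, hne, le_sup_left, sup_le_sup_right hτW P⟩, le_sup_right⟩, ?_⟩
  rintro K ⟨⟨⟨hK, -⟩, π, hπ, hWπ, -, hτK, hKπ⟩, hPK⟩
  obtain rfl : W ⊔ P = π :=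
    Submodule.eq_of_le_of_finrank_eq (sup_le hWπ (hPK.trans hKπ)) (hrank.trans hπ.symm)
  exact (Submodule.eq_of_le_of_finrank_eq (sup_le hτK hPK) (hKr.trans hK.symm)).symm
end

section
/- Let q be a prime power, F a finite field with q elements, 1 ≤ k ≤ n−1. If 𝓛 is a Cameron–Liebler k-set of AG(n,q), then for every k-spread S of AG(n,q) one has |𝓛 ∩ S| · [n k]_q = |𝓛|; in particular, if 𝓛 has parameter x (i.e. |𝓛| = x·[n k]_q) then every k-spread of AG(n,q) meets 𝓛 in exactly x elements. -/
open Module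

variable {F : Type} [Field F] [Fintype F] {n : ℕ}

/-- A linearly independent `k`-tuple is a `k`-dimensional subspace together with
a linearly independent `k`-tuple in that subspace. -/
noncomputable def linearIndependentEquivSigma {K V : Type*} [Field K] [AddCommGroup V] [Module K V]
    [FiniteDimensional K V] (k : ℕ) :
    {s : Fin k → V // LinearIndependent K s} ≃
      Σ W : {W : Submodule K V // finrank K W = k},
        {t : Fin k → W.1 // LinearIndependent K t} :=
  Equiv.symm <| Equiv.ofBijective
    (fun x => ⟨fun i => (x.2.1 i : V),
      x.2.2.map' x.1.1.subtype (Submodule.ker_subtype _)⟩) <| by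
    have hspan : ∀ x : Σ W : {W : Submodule K V // finrank K W = k},
        {t : Fin k → W.1 // LinearIndependent K t},
        Submodule.span K (Set.range fun i => (x.2.1 i : V)) = x.1.1 := by
      rintro ⟨⟨W, hW⟩, t, ht⟩
      apply Submodule.eq_of_le_of_finrank_eq
      · rw [Submodule.span_le]
        rintro _ ⟨i, rfl⟩
        exact (t i).2
      · refine (finrank_span_eq_card (ht.map' W.subtype (Submodule.ker_subtype _))).trans ?_
        rw [Fintype.card_fin, hW]
    constructor
    · intro x y hxy
      have hfun := congrArg Subtype.val hxy
      have hW : x.1.1 = y.1.1 := by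
        rw [← hspan x, ← hspan y]
        exact congrArg (fun f => Submodule.span K (Set.range f)) hfun
      obtain ⟨⟨W, hx⟩, t, ht⟩ := x
      obtain ⟨⟨W', hy⟩, t', ht'⟩ := y
      obtain rfl : W = W' := hW
      have : t = t' := by
        funext i
        exact Subtype.ext (congrFun hfun i)
      subst this
      rfl
    · rintro ⟨s, hs⟩
      refine ⟨⟨⟨Submodule.span K (Set.range s), ?_⟩,
        fun i => ⟨s i, Submodule.subset_span ⟨i, rfl⟩⟩, ?_⟩, rfl⟩
      · rw [finrank_span_eq_card hs, Fintype.card_fin]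
      · exact LinearIndependent.of_comp (Submodule.subtype _) hs

theorem cast_prod_pow_sub_pow {q : ℕ} (hq : 1 ≤ q) {k m : ℕ} (hk : k ≤ m) :
    ((∏ i : Fin k, (q ^ m - q ^ (i : ℕ)) : ℕ) : ℚ) =
      (∏ i ∈ Finset.range k, (q : ℚ) ^ i) *
        ∏ i ∈ Finset.range k, ((q : ℚ) ^ (m - i) - 1) := by
  rw [Fin.prod_univ_eq_prod_range (fun i => q ^ m - q ^ i) k, Nat.cast_prod,
    ← Finset.prod_mul_distrib]
  refine Finset.prod_congr rfl fun i hi => ?_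
  have him : i ≤ m := (Finset.mem_range.1 hi).le.trans hk
  rw [Nat.cast_sub (Nat.pow_le_pow_right hq him), mul_sub, ← pow_add, Nat.add_sub_cancel' him]
  push_cast
  ring

theorem gaussBinom_mul_card {q : ℕ} (hq : 2 ≤ q) {k m : ℕ} (hk : k ≤ m) :
    gaussBinom q m k * ((∏ i : Fin k, (q ^ k - q ^ (i : ℕ)) : ℕ) : ℚ) =
      ((∏ i : Fin k, (q ^ m - q ^ (i : ℕ)) : ℕ) : ℚ) := by
  have hq1 : 1 ≤ q := by lia
  rw [cast_prod_pow_sub_pow hq1 hk, cast_prod_pow_sub_pow hq1 le_rfl, gaussBinom,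
    Finset.prod_div_distrib]
  have hrefl : ∏ i ∈ Finset.range k, ((q : ℚ) ^ (k - i) - 1) =
      ∏ i ∈ Finset.range k, ((q : ℚ) ^ (i + 1) - 1) := by
    rw [← Finset.prod_range_reflect]
    refine Finset.prod_congr rfl fun i hi => ?_
    have := Finset.mem_range.1 hi
    congr 2
    lia
  have hne : ∏ i ∈ Finset.range k, ((q : ℚ) ^ (i + 1) - 1) ≠ 0 := by
    refine Finset.prod_ne_zero_iff.2 fun i _ => (sub_pos.2 ?_).ne'
    exact one_lt_pow₀ (by exact_mod_cast hq) (Nat.succ_ne_zero i)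
  rw [hrefl]
  field_simp

theorem gaussBinom_pos {q : ℕ} (hq : 2 ≤ q) {k m : ℕ} (hk : k ≤ m) : 0 < gaussBinom q m k := by
  have hq' : (1 : ℚ) < q := by exact_mod_cast hq
  refine Finset.prod_pos fun i hi => div_pos (sub_pos.2 ?_) (sub_pos.2 ?_)
  · exact one_lt_pow₀ hq' (by have := Finset.mem_range.1 hi; lia)
  · exact one_lt_pow₀ hq' (Nat.succ_ne_zero i)

/-- The number of `k`-dimensional subspaces of a finite vector space. -/
theorem card_submodule_finrank_eq {K V : Type*} [Field K] [Fintype K] [AddCommGroup V] [Module K V]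
    [Finite V] {k : ℕ} (hk : k ≤ finrank K V) :
    (Nat.card {W : Submodule K V // finrank K W = k} : ℚ) =
      gaussBinom (Fintype.card K) (finrank K V) k := by
  have hq : 2 ≤ Fintype.card K := Fintype.one_lt_card
  have := Fintype.ofFinite {W : Submodule K V // finrank K W = k}
  have hcount := Nat.card_congr (linearIndependentEquivSigma (K := K) (V := V) k)
  rw [card_linearIndependent hk, Nat.card_sigma,
    Finset.sum_congr rfl fun W _ => (card_linearIndependent W.2.ge).trans (by rw [W.2])] at hcount
  rw [Finset.sum_const, smul_eq_mul, Finset.card_univ] at hcount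
  simp only [← Nat.card_eq_fintype_card] at hcount
  have hne : ((∏ i : Fin k, (Fintype.card K ^ k - Fintype.card K ^ (i : ℕ)) : ℕ) : ℚ) ≠ 0 := by
    rw [Nat.cast_ne_zero]
    exact Finset.prod_ne_zero_iff.2 fun i _ =>
      (Nat.sub_pos_of_lt (Nat.pow_lt_pow_right hq i.2)).ne'
  apply mul_right_cancel₀ hne
  rw [gaussBinom_mul_card hq hk]
  simp only [← Nat.card_eq_fintype_card]
  rw [hcount, Nat.cast_mul]

/-- The number of subspaces of dimension `k + 1` through a given one-dimensional subspace. -/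
theorem card_submodule_through_point {K V : Type*} [Field K] [Fintype K] [AddCommGroup V]
    [Module K V] [Finite V] {k m : ℕ} (hV : finrank K V = m + 1) (hk : k ≤ m)
    {P : Submodule K V} (hP : finrank K P = 1) :
    (Nat.card {W : Submodule K V // finrank K W = k + 1 ∧ P ≤ W} : ℚ) =
      gaussBinom (Fintype.card K) m k := by
  have hquot : finrank K (V ⧸ P) = m := by
    have := P.finrank_quotient_add_finrank
    lia
  have hrank : ∀ W : Submodule K (V ⧸ P),
      finrank K (W.comap P.mkQ) = finrank K W + 1 := by
    intro W
    have hle : P ≤ W.comap P.mkQ := Submodule.le_comap_mkQ P W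
    have h1 := (W.comap P.mkQ).finrank_quotient_add_finrank
    have h2 := W.finrank_quotient_add_finrank
    have h3 := (Submodule.quotientQuotientEquivQuotient P (W.comap P.mkQ) hle).finrank_eq
    rw [Submodule.map_comap_eq_of_surjective P.mkQ_surjective] at h3
    lia
  have : Finite (V ⧸ P) := Finite.of_surjective _ P.mkQ_surjective
  rw [← hquot, ← card_submodule_finrank_eq (hk.trans hquot.ge), Nat.cast_inj]
  refine Nat.card_congr (Equiv.ofBijective
    (fun W => ⟨W.1.comap P.mkQ, by rw [hrank, W.2], Submodule.le_comap_mkQ P W.1⟩) ⟨?_, ?_⟩).symm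
  · intro W W' h
    exact Subtype.ext (Submodule.comap_injective_of_surjective P.mkQ_surjective
      (congrArg Subtype.val h))
  · rintro ⟨W, hW, hPW⟩
    have hW' : (W.map P.mkQ).comap P.mkQ = W := by
      rw [Submodule.comap_map_mkQ, sup_eq_right.2 hPW]
    refine ⟨⟨W.map P.mkQ, ?_⟩, Subtype.ext hW'⟩
    have := hrank (W.map P.mkQ)
    rw [hW', hW] at this
    lia

/-- If every affine point lies on exactly `c` members of a set `T` of affine `k`-spaces, then
a set `L` with point weights `w` meets `T` in `c` times the total weight. -/
theorem ncard_inter_eq_mul_sum_weight {k c : ℕ} {Hinf : Submodule F (Fin (n + 1) → F)}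
    {L T : Set (Submodule F (Fin (n + 1) → F))} {w : Submodule F (Fin (n + 1) → F) → ℝ}
    (hw : ∀ K, IsAffSub k Hinf K →
      Set.indicator L (fun _ => (1 : ℝ)) K = ∑ᶠ P ∈ {P | IsAffPoint Hinf P ∧ P ≤ K}, w P)
    (hT : ∀ K ∈ T, IsAffSub k Hinf K)
    (hc : ∀ P, IsAffPoint Hinf P → {K | K ∈ T ∧ P ≤ K}.ncard = c) :
    ((L ∩ T).ncard : ℝ) = c * ∑ᶠ P ∈ {P | IsAffPoint Hinf P}, w P := by
  classical
  have := Fintype.ofFinite (Submodule F (Fin (n + 1) → F))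
  have hsum : ∀ p : Submodule F (Fin (n + 1) → F) → Prop,
      ∑ᶠ P ∈ {P | p P}, w P = ∑ P, if p P then w P else 0 := by
    intro p
    rw [finsum_mem_def, finsum_eq_sum_of_fintype]
    simp only [Set.indicator_apply, Set.mem_ofPred_eq]
  have hcard : ((L ∩ T).ncard : ℝ) = ∑ K with K ∈ T, Set.indicator L (fun _ => (1 : ℝ)) K := by
    rw [Set.ncard_eq_toFinset_card']
    simp only [Set.indicator_apply, Finset.sum_boole, Finset.filter_filter]
    congr 2
    ext K
    simp [and_comm]
  rw [hcard, hsum, Finset.mul_sum, Finset.sum_congr rfl fun K hK =>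
    (hw K (hT K (Finset.mem_filter.1 hK).2)).trans (hsum _), Finset.sum_comm]
  refine Finset.sum_congr rfl fun P _ => ?_
  by_cases hP : IsAffPoint Hinf P
  · simp only [hP, true_and, if_true]
    rw [← Finset.sum_filter, Finset.sum_const, nsmul_eq_mul, Finset.filter_filter, ← hc P hP,
      Set.ncard_eq_toFinset_card']
    congr 3
    ext K
    simp
  · simp [hP]

theorem statement3 (q k : ℕ) (hq : IsPrimePow q) (hF : Fintype.card F = q)
    (hk : 1 ≤ k) (hkn : k ≤ n - 1)
    (Hinf : Submodule F (Fin (n + 1) → F)) (hH : Module.finrank F Hinf = n)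
    (L : Set (Submodule F (Fin (n + 1) → F)))
    (hL : IsCLAff k Hinf L) :
    (∀ S, IsSpread k Hinf S →
      ((L ∩ S).ncard : ℚ) * gaussBinom q n k = (L.ncard : ℚ)) ∧
    ∀ x : ℕ, (L.ncard : ℚ) = (x : ℚ) * gaussBinom q n k →
      ∀ S, IsSpread k Hinf S → (L ∩ S).ncard = x := by
  obtain ⟨hLsub, w, hw⟩ := hL
  have hkn' : k ≤ n := by lia
  have hpos : 0 < gaussBinom q n k := gaussBinom_pos hq.two_le hkn'
  have hmain : ∀ S, IsSpread k Hinf S →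
      ((L ∩ S).ncard : ℚ) * gaussBinom q n k = (L.ncard : ℚ) := by
    rintro S ⟨hS, hS1⟩
    have hspread := ncard_inter_eq_mul_sum_weight (c := 1) hw hS fun P hP => by
      obtain ⟨K, hK, huniq⟩ := hS1 P hP
      exact Set.ncard_eq_one.2 ⟨K, Set.eq_singleton_iff_unique_mem.2 ⟨hK, huniq⟩⟩
    have hthrough : ∀ P, IsAffPoint Hinf P →
        ({K | K ∈ {K | IsAffSub k Hinf K} ∧ P ≤ K}.ncard : ℚ) = gaussBinom q n k := by
      rintro P ⟨hP, hPH⟩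
      have hset : {K | K ∈ {K | IsAffSub k Hinf K} ∧ P ≤ K} =
          {K : Submodule F (Fin (n + 1) → F) | finrank F K = k + 1 ∧ P ≤ K} := by
        ext K
        exact ⟨fun h => ⟨h.1.1, h.2⟩, fun h => ⟨⟨h.1, fun hK => hPH (h.2.trans hK)⟩, h.2⟩⟩
      rw [hset, ← Nat.card_coe_set_eq, ← hF]
      exact card_submodule_through_point (by simp) hkn' hP
    obtain ⟨c, hc⟩ : ∃ c : ℕ, (c : ℚ) = gaussBinom q n k := by
      have := card_submodule_finrank_eq (K := F) (V := Fin n → F) (k := k) (by simpa using hkn')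
      rw [finrank_fin_fun, hF] at this
      exact ⟨_, this⟩
    have hall := ncard_inter_eq_mul_sum_weight (c := c) hw (T := {K | IsAffSub k Hinf K})
      (fun K hK => hK) fun P hP => by exact_mod_cast (hthrough P hP).trans hc.symm
    rw [show L ∩ {K | IsAffSub k Hinf K} = L from Set.inter_eq_left.2 fun K hK => hLsub K hK] at hall
    rw [Nat.cast_one, one_mul] at hspread
    rw [← hspread] at hall
    rw [← hc, mul_comm]
    exact_mod_cast hall.symm
  refine ⟨hmain, fun x hx S hS => ?_⟩
  exact_mod_cast mul_right_cancel₀ hpos.ne' ((hmain S hS).trans hx)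
end

section
/- Let q be a prime power, F a finite field with q elements, k ≥ 1 and n ≥ 2k+1. Let 𝓛 be a set of affine k-spaces and x a natural number such that |𝓛 ∩ S| = x for every k-spread S of AG(n,q). Then 𝓛 is a Cameron–Liebler k-set of AG(n,q) (with parameter x, i.e. |𝓛| = x·[n k]_q). -/
open Module

variable {F : Type} [Field F] [Fintype F] {n : ℕ}

section Counting

variable {A : Type*} [AddCommGroup A] [Module F A] [Fintype A]

omit [Fintype F] [Fintype A] in
lemma exists_submodule_le_finrank_eq (H : Submodule F A) {d : ℕ} (hd : d ≤ finrank F H) :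
    ∃ W ≤ H, finrank F W = d := by
  obtain ⟨v, hv⟩ := exists_linearIndependent_of_le_finrank hd
  have hv' : LinearIndependent F (fun i => (v i : A)) := hv.map' H.subtype H.ker_subtype
  refine ⟨Submodule.span F (Set.range fun i => (v i : A)), ?_, ?_⟩
  · rw [Submodule.span_le]
    rintro _ ⟨i, rfl⟩
    exact (v i).2
  · simpa using finrank_span_eq_card hv'

open scoped Classical in
lemma card_mul_card_fiber_eq (g : A →ₗ[F] F) (hg : g ≠ 0) (t : F) :
    Fintype.card F * (Finset.univ.filter fun u => g u = t).card = Fintype.card A := by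
  have hs : ∀ s : F, (Finset.univ.filter fun u => g u = s).card =
      (Finset.univ.filter fun u => g u = t).card := by
    intro s
    obtain ⟨u, hu⟩ := LinearMap.surjective hg (t - s)
    refine Finset.card_nbij' (· + u) (· - u) ?_ ?_ ?_ ?_
    · intro x hx; simp at hx ⊢; simp [hx, hu]
    · intro x hx; simp at hx ⊢; simp [hx, hu]
    · intro x _; simp
    · intro x _; simp
  have := Finset.card_eq_sum_card_fiberwise (f := g) (s := Finset.univ) (t := Finset.univ)
    (by simp)
  rw [Finset.sum_congr rfl fun s _ => hs s] at this
  simpa using this.symm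

open scoped Classical in
lemma card_filter_sub_mem (W : Submodule F A) (a : A) :
    (Finset.univ.filter fun c => c - a ∈ W).card = Fintype.card F ^ finrank F W := by
  rw [← Module.card_eq_pow_finrank (K := F) (V := W), Fintype.card_subtype]
  refine Finset.card_nbij' (· - a) (· + a) ?_ ?_ ?_ ?_ <;> intro x <;> simp

open scoped Classical in
lemma card_mul_card_filter_sub_mem (W : Submodule F A) (φ : A →ₗ[F] F)
    (hφ : ¬ W ≤ LinearMap.ker φ) (a : A) (t : F) :
    Fintype.card F * (Finset.univ.filter fun c => c - a ∈ W ∧ φ c = t).card =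
      Fintype.card F ^ finrank F W := by
  have hg : φ.domRestrict W ≠ 0 := by
    intro h
    apply hφ
    intro u hu
    exact congrArg (fun g => g ⟨u, hu⟩) h
  rw [← Module.card_eq_pow_finrank (K := F) (V := W),
    ← card_mul_card_fiber_eq (φ.domRestrict W) hg (t - φ a)]
  congr 1
  symm
  refine Finset.card_bij (fun u _ => (u : A) + a) ?_ ?_ ?_
  · intro u hu
    have hu' : φ u = t - φ a := (Finset.mem_filter.1 hu).2
    exact Finset.mem_filter.2 ⟨Finset.mem_univ _, by simp [hu']⟩
  · intro u _ v _ h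
    exact Subtype.ext (add_right_cancel h)
  · intro c hc
    simp at hc
    exact ⟨⟨c - a, hc.1⟩, Finset.mem_filter.2 ⟨Finset.mem_univ _, by simp [hc.2]⟩, by simp⟩

open scoped Classical in
lemma card_mul_card_annihilator (W : Submodule F A) [Fintype (A →ₗ[F] F)] :
    Fintype.card F ^ finrank F W *
      (Finset.univ.filter fun φ : A →ₗ[F] F => W ≤ LinearMap.ker φ).card =
      Fintype.card F ^ finrank F A := by
  have h : (Finset.univ.filter fun φ : A →ₗ[F] F => W ≤ LinearMap.ker φ).card =
      Nat.card W.dualAnnihilator := by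
    rw [Nat.card_eq_fintype_card]
    symm
    refine (Fintype.card_subtype _).trans ?_
    congr 1
    ext φ
    simp [Submodule.mem_dualAnnihilator, SetLike.le_def]
  rw [h, Module.natCard_eq_pow_finrank (K := F), Nat.card_eq_fintype_card, ← pow_add,
    Subspace.finrank_add_finrank_dualAnnihilator_eq]

open scoped Classical in
lemma card_mul_card_annihilator_of_notMem (W : Submodule F A) [Fintype (A →ₗ[F] F)] {v : A}
    (hv : v ∉ W) :
    Fintype.card F * (Finset.univ.filter fun φ : A →ₗ[F] F =>
        W ≤ LinearMap.ker φ ∧ φ v = 0).card =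
      (Finset.univ.filter fun φ : A →ₗ[F] F => W ≤ LinearMap.ker φ).card := by
  obtain ⟨φ, hφ, hW⟩ := Submodule.exists_le_ker_of_notMem hv
  have hker : ∀ ψ : A →ₗ[F] F, W ≤ LinearMap.ker ψ ↔ ψ ∈ W.dualAnnihilator := by
    intro ψ
    simp [Submodule.mem_dualAnnihilator, SetLike.le_def]
  have := card_mul_card_filter_sub_mem (F := F) (A := A →ₗ[F] F) W.dualAnnihilator
    (LinearMap.applyₗ v) (fun h => hφ (h ((hker φ).1 hW))) 0 0
  rw [← card_filter_sub_mem _ 0] at this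
  simpa [hker] using this

end Counting

section Core

variable {A : Type*} [AddCommGroup A] [Module F A] [Fintype A]

open scoped Classical in
/-- A family of real functions, one for each `k`-subspace `W` and constant on the cosets of `W`,
whose sums over the level sets of any linear form vanishing on `W` do not depend on `W`, consists of
the coset sums of a single function. -/
lemma exists_weight_of_level_sums (k : ℕ) (hk : k + 1 ≤ finrank F A)
    (f : Submodule F A → A → ℝ) (X : ℝ)
    (hf : ∀ W : Submodule F A, finrank F W = k → ∀ a b, b - a ∈ W → f W b = f W a)
    (hX : ∀ W : Submodule F A, finrank F W = k → ∑ b, f W b = X)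
    (hT : ∀ (φ : A →ₗ[F] F) (W W' : Submodule F A), finrank F W = k → finrank F W' = k →
      W ≤ LinearMap.ker φ → W' ≤ LinearMap.ker φ → ∀ t,
      ∑ b, (if φ b = t then f W b else 0) = ∑ b, (if φ b = t then f W' b else 0)) :
    ∃ w : A → ℝ, ∀ W : Submodule F A, finrank F W = k → ∀ a,
      f W a = ∑ b, if b - a ∈ W then w b else 0 := by
  have hex : ∀ φ : A →ₗ[F] F, ∃ W ≤ LinearMap.ker φ, finrank F W = k := by
    intro φ
    apply exists_submodule_le_finrank_eq
    have h1 := φ.finrank_range_add_finrank_ker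
    have h2 := Submodule.finrank_le (LinearMap.range φ)
    rw [finrank_self] at h2
    omega
  choose D hDle hD using hex
  let _ : Fintype (A →ₗ[F] F) := 
    have : Finite (A →ₗ[F] F) := .of_injective _ DFunLike.coe_injective
    Fintype.ofFinite _
  set Q : ℝ := (Fintype.card F : ℝ) with hQ
  have hQ1 : 1 < Q := by
    rw [hQ]; exact_mod_cast Fintype.one_lt_card
  have hQ0 : Q ≠ 0 := by positivity
  have hQk : Q ^ k ≠ 0 := by positivity
  set N : ℝ := Q ^ finrank F A with hN
  have hN0 : N ≠ 0 := by positivity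
  set G : (A →ₗ[F] F) → A → ℝ := fun φ c => ∑ b, if φ b = φ c then f (D φ) b else 0 with hG
  refine ⟨fun c => (∑ φ, G φ c - N / Q * X) / (N * Q ^ k * (1 - 1 / Q)), fun W hW a => ?_⟩
  have hcoset : ((Finset.univ.filter fun c => c - a ∈ W).card : ℝ) = Q ^ k := by
    rw [card_filter_sub_mem, hW]; push_cast; rfl
  have hin : ∀ φ : A →ₗ[F] F, W ≤ LinearMap.ker φ →
      ∑ c, (if c - a ∈ W then G φ c else 0) =
        Q ^ k * ∑ b, if φ b = φ a then f W b else 0 := by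
    intro φ hφ
    rw [← hcoset, ← Finset.sum_filter, ← nsmul_eq_mul, ← Finset.sum_const]
    refine Finset.sum_congr rfl fun c hc => ?_
    have hc' : φ c = φ a := by
      have := hφ (Finset.mem_filter.1 hc).2
      rwa [LinearMap.mem_ker, map_sub, sub_eq_zero] at this
    rw [hG]
    simp only [hc']
    exact hT φ _ _ (hD φ) hW (hDle φ) hφ _
  have hout : ∀ φ : A →ₗ[F] F, ¬ W ≤ LinearMap.ker φ →
      ∑ c, (if c - a ∈ W then G φ c else 0) = Q ^ k / Q * X := by
    intro φ hφ
    have hcard : ∀ t, ((Finset.univ.filter fun c => c - a ∈ W ∧ φ c = t).card : ℝ) =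
        Q ^ k / Q := by
      intro t
      rw [eq_div_iff hQ0, mul_comm, hQ, ← hW]
      exact_mod_cast card_mul_card_filter_sub_mem W φ hφ a t
    have h1 : ∀ c, (if c - a ∈ W then G φ c else 0) =
        ∑ b, if c - a ∈ W ∧ φ c = φ b then f (D φ) b else 0 := by
      intro c
      by_cases h : c - a ∈ W <;> simp [h, hG, eq_comm]
    simp only [h1]
    rw [Finset.sum_comm, ← hX _ (hD φ), Finset.mul_sum]
    refine Finset.sum_congr rfl fun b _ => ?_
    rw [← Finset.sum_filter, Finset.sum_const, nsmul_eq_mul, hcard]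
  have hann : ((Finset.univ.filter fun φ : A →ₗ[F] F => W ≤ LinearMap.ker φ).card : ℝ) =
      N / Q ^ k := by
    rw [eq_div_iff hQk, mul_comm, hN, hQ, ← hW]
    exact_mod_cast card_mul_card_annihilator W
  have hann' : ∀ v ∉ W, ((Finset.univ.filter fun φ : A →ₗ[F] F =>
      W ≤ LinearMap.ker φ ∧ φ v = 0).card : ℝ) = N / Q ^ k / Q := by
    intro v hv
    rw [eq_div_iff hQ0, mul_comm, ← hann, hQ]
    exact_mod_cast card_mul_card_annihilator_of_notMem W hv
  have hall : (Finset.card (Finset.univ : Finset (A →ₗ[F] F)) : ℝ) = N := by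
    have := card_mul_card_annihilator (⊥ : Submodule F A)
    simp only [bot_le, finrank_bot, pow_zero, one_mul, Finset.filter_true] at this
    rw [this, hN, hQ]; push_cast; rfl
  have hnot : ((Finset.univ.filter fun φ : A →ₗ[F] F => ¬ W ≤ LinearMap.ker φ).card : ℝ) =
      N - N / Q ^ k := by
    rw [← hann, ← hall, ← Finset.card_filter_add_card_filter_not
      (s := (Finset.univ : Finset (A →ₗ[F] F))) (fun φ => W ≤ LinearMap.ker φ)]
    push_cast; ring
  have hpair : ∀ b, (∑ φ : A →ₗ[F] F, if W ≤ LinearMap.ker φ ∧ φ b = φ a then f W b else 0) =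
      N / Q ^ k / Q * f W b + if b - a ∈ W then (N / Q ^ k - N / Q ^ k / Q) * f W a else 0 := by
    intro b
    rw [← Finset.sum_filter, Finset.sum_const, nsmul_eq_mul]
    by_cases h : b - a ∈ W
    · have : (Finset.univ.filter fun φ : A →ₗ[F] F => W ≤ LinearMap.ker φ ∧ φ b = φ a) =
          Finset.univ.filter fun φ : A →ₗ[F] F => W ≤ LinearMap.ker φ := by
        ext φ
        simp only [Finset.mem_filter_univ, and_iff_left_iff_imp]
        intro hφ
        have := hφ h
        rwa [LinearMap.mem_ker, map_sub, sub_eq_zero] at this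
      rw [this, hann, if_pos h, hf W hW a b h]
      ring
    · rw [if_neg h, ← hann' _ h]
      simp [sub_eq_zero]
  have hsum : ∑ c, (if c - a ∈ W then ∑ φ, G φ c else 0) =
      Q ^ k * (N / Q ^ k / Q * X + Q ^ k * ((N / Q ^ k - N / Q ^ k / Q) * f W a)) +
        (N - N / Q ^ k) * (Q ^ k / Q * X) := by
    have h1 : ∀ c, (if c - a ∈ W then ∑ φ, G φ c else 0) =
        ∑ φ, if c - a ∈ W then G φ c else 0 := by
      intro c
      by_cases h : c - a ∈ W <;> simp [h]
    simp only [h1]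
    rw [Finset.sum_comm, ← Finset.sum_filter_add_sum_filter_not Finset.univ
      (fun φ : A →ₗ[F] F => W ≤ LinearMap.ker φ)]
    congr 1
    · rw [Finset.sum_congr rfl fun φ hφ => hin φ (Finset.mem_filter.1 hφ).2, ← Finset.mul_sum,
        Finset.sum_comm]
      congr 1
      have h2 : ∀ b, (∑ φ ∈ Finset.univ.filter (fun φ : A →ₗ[F] F => W ≤ LinearMap.ker φ),
          if φ b = φ a then f W b else 0) =
          ∑ φ : A →ₗ[F] F, if W ≤ LinearMap.ker φ ∧ φ b = φ a then f W b else 0 := by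
        intro b
        rw [Finset.sum_filter]
        refine Finset.sum_congr rfl fun φ _ => ?_
        by_cases h : W ≤ LinearMap.ker φ <;> simp [h]
      simp only [h2, hpair]
      rw [Finset.sum_add_distrib, ← Finset.mul_sum, hX W hW, ← Finset.sum_filter,
        Finset.sum_const, nsmul_eq_mul, hcoset]
    · rw [Finset.sum_congr rfl fun φ hφ => hout φ (Finset.mem_filter.1 hφ).2, Finset.sum_const,
        nsmul_eq_mul, hnot]
  rw [← Finset.sum_filter] at hsum ⊢
  rw [← Finset.sum_div, Finset.sum_sub_distrib, hsum, Finset.sum_const, nsmul_eq_mul, hcoset]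
  have hQ2 : Q - 1 ≠ 0 := by linarith
  have hQ3 : 1 - 1 / Q ≠ 0 := by
    rw [one_sub_div hQ0]; exact div_ne_zero hQ2 hQ0
  rw [eq_div_iff (by positivity)]
  field_simp
  ring

end Core

section SubspaceCount

variable {A : Type*} [AddCommGroup A] [Module F A] [Fintype A]

omit [Fintype F] [Fintype A] in
/-- Linearly independent `k`-tuples, sorted by the subspace they span. -/
lemma nonempty_equiv_sigma_linearIndependent [Module.Finite F A] (k : ℕ) :
    Nonempty ({s : Fin k → A // LinearIndependent F s} ≃
      Σ W : {W : Submodule F A // finrank F W = k},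
        {s : Fin k → W.1 // LinearIndependent F s}) := by
  let g : (Σ W : {W : Submodule F A // finrank F W = k},
      {s : Fin k → W.1 // LinearIndependent F s}) →
        {s : Fin k → A // LinearIndependent F s} := fun p =>
    ⟨fun i => (p.2.1 i : A), p.2.2.map' p.1.1.subtype p.1.1.ker_subtype⟩
  have hspan : ∀ p, Submodule.span F (Set.range (g p).1) = p.1.1 := by
    intro p
    have hfin : finrank F (Submodule.span F (Set.range (g p).1)) = k := by
      simpa using finrank_span_eq_card (g p).2
    refine Submodule.eq_of_le_of_finrank_eq ?_ (hfin.trans p.1.2.symm)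
    rw [Submodule.span_le]
    rintro _ ⟨i, rfl⟩
    exact (p.2.1 i).2
  refine ⟨(Equiv.ofBijective g ⟨?_, ?_⟩).symm⟩
  · rintro ⟨⟨W, hW⟩, s, hs⟩ ⟨⟨W', hW'⟩, s', hs'⟩ h
    have h1 : W = W' := by
      have h2 := hspan ⟨⟨W, hW⟩, s, hs⟩
      rw [h, hspan] at h2
      exact h2.symm
    subst h1
    have h3 : s = s' := funext fun i => Subtype.ext (congrFun (congrArg Subtype.val h) i)
    subst h3
    rfl
  · rintro ⟨s, hs⟩
    refine ⟨⟨⟨Submodule.span F (Set.range s), by simpa using finrank_span_eq_card hs⟩,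
      fun i => ⟨s i, Submodule.subset_span ⟨i, rfl⟩⟩, ?_⟩, rfl⟩
    exact LinearIndependent.of_comp (Submodule.subtype _) hs

lemma card_subspaces_mul_prod (k : ℕ) (hk : k ≤ finrank F A) :
    Nat.card {W : Submodule F A // finrank F W = k} *
        ∏ i ∈ Finset.range k, (Fintype.card F ^ k - Fintype.card F ^ i) =
      ∏ i ∈ Finset.range k, (Fintype.card F ^ finrank F A - Fintype.card F ^ i) := by
  obtain ⟨e⟩ := nonempty_equiv_sigma_linearIndependent (F := F) (A := A) k
  have : Finite (Submodule F A) := .of_injective _ SetLike.coe_injective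
  let _ : Fintype {W : Submodule F A // finrank F W = k} := Fintype.ofFinite _
  have h := Nat.card_congr e
  rw [card_linearIndependent hk, Nat.card_sigma] at h
  rw [Finset.prod_range, Finset.prod_range, h, Nat.card_eq_fintype_card, ← Finset.card_univ,
    ← smul_eq_mul, ← Finset.sum_const]
  refine Finset.sum_congr rfl fun W _ => ?_
  rw [card_linearIndependent W.2.ge, W.2]

/-- The Gaussian binomial coefficient counts the `k`-subspaces. -/
lemma card_subspaces_eq_gaussBinom (k : ℕ) (hk : k ≤ finrank F A) :
    (Nat.card {W : Submodule F A // finrank F W = k} : ℚ) =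
      gaussBinom (Fintype.card F) (finrank F A) k := by
  have hq : 1 < Fintype.card F := Fintype.one_lt_card
  have hq' : (1 : ℚ) < Fintype.card F := by exact_mod_cast hq
  have hne : ∀ m : ℕ, m ≠ 0 → (Fintype.card F : ℚ) ^ m - 1 ≠ 0 := fun m hm =>
    (sub_pos.2 (one_lt_pow₀ hq' hm)).ne'
  have hcast : ∀ m, k ≤ m →
      ((∏ i ∈ Finset.range k, (Fintype.card F ^ m - Fintype.card F ^ i) : ℕ) : ℚ) =
        (∏ i ∈ Finset.range k, (Fintype.card F : ℚ) ^ i) *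
          ∏ i ∈ Finset.range k, ((Fintype.card F : ℚ) ^ (m - i) - 1) := by
    intro m hm
    rw [Nat.cast_prod, ← Finset.prod_mul_distrib]
    refine Finset.prod_congr rfl fun i hi => ?_
    have hi' : i ≤ m := (Finset.mem_range.1 hi).le.trans hm
    rw [Nat.cast_sub (Nat.pow_le_pow_right hq.le hi'), mul_sub, ← pow_add,
      Nat.add_sub_cancel' hi']
    push_cast
    ring
  have h := congrArg (Nat.cast : ℕ → ℚ) (card_subspaces_mul_prod (F := F) (A := A) k hk)
  rw [Nat.cast_mul, hcast k le_rfl, hcast _ hk] at h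
  have hrefl : ∏ i ∈ Finset.range k, ((Fintype.card F : ℚ) ^ (k - i) - 1) =
      ∏ i ∈ Finset.range k, ((Fintype.card F : ℚ) ^ (i + 1) - 1) := by
    rw [← Finset.prod_range_reflect]
    refine Finset.prod_congr rfl fun i hi => ?_
    have := Finset.mem_range.1 hi
    congr 2
    omega
  have h0 : ∏ i ∈ Finset.range k, (Fintype.card F : ℚ) ^ i ≠ 0 :=
    Finset.prod_ne_zero_iff.2 fun i _ => pow_ne_zero _ (by positivity)
  rw [gaussBinom, Finset.prod_div_distrib, eq_div_iff
    (Finset.prod_ne_zero_iff.2 fun i _ => hne _ i.succ_ne_zero), ← hrefl]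
  apply mul_left_cancel₀ h0
  linarith

end SubspaceCount

section Flats

variable {V A : Type*} [AddCommGroup V] [Module F V] [AddCommGroup A] [Module F A]

/-- In coordinates `E : V ≃ F × A`, the affine subspace through `(1, a)` with direction `W`. -/
def flat (E : V ≃ₗ[F] F × A) (W : Submodule F A) (a : A) : Submodule F V :=
  W.comap ((LinearMap.snd F F A - (LinearMap.fst F F A).smulRight a) ∘ₗ E.toLinearMap)

omit [Fintype F] in
lemma mem_flat {E : V ≃ₗ[F] F × A} {W : Submodule F A} {a : A} {v : V} :
    v ∈ flat E W a ↔ (E v).2 - (E v).1 • a ∈ W := by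
  simp [flat]

omit [Fintype F] in
lemma symm_one_mem_flat {E : V ≃ₗ[F] F × A} {W : Submodule F A} {a b : A} :
    E.symm (1, b) ∈ flat E W a ↔ b - a ∈ W := by
  simp [mem_flat]

omit [Fintype F] in
lemma symm_zero_mem_flat {E : V ≃ₗ[F] F × A} {W : Submodule F A} {a b : A} :
    E.symm (0, b) ∈ flat E W a ↔ b ∈ W := by
  simp [mem_flat]

omit [Fintype F] in
lemma finrank_flat [Module.Finite F A] (E : V ≃ₗ[F] F × A) (W : Submodule F A) (a : A) :
    finrank F (flat E W a) = finrank F W + 1 := by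
  let j : F × W →ₗ[F] V := E.symm.toLinearMap ∘ₗ (LinearMap.fst F F W).prod
    (W.subtype ∘ₗ LinearMap.snd F F W + (LinearMap.fst F F W).smulRight a)
  have hj : ∀ p, j p = E.symm (p.1, (p.2 : A) + p.1 • a) := fun p => rfl
  have hinj : Function.Injective j := by
    rintro ⟨s, u⟩ ⟨t, v⟩ h
    rw [hj, hj, E.symm.injective.eq_iff, Prod.mk.injEq] at h
    obtain ⟨h1, h2⟩ := h
    simp only at h1 h2
    subst h1
    exact Prod.ext rfl (Subtype.ext (add_right_cancel h2))
  have hrange : LinearMap.range j = flat E W a := by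
    ext v
    rw [mem_flat]
    constructor
    · rintro ⟨p, rfl⟩
      simp [hj]
    · intro h
      refine ⟨((E v).1, ⟨_, h⟩), ?_⟩
      rw [hj, E.symm_apply_eq]
      simp
  rw [← hrange, LinearMap.finrank_range_of_inj hinj, finrank_prod, finrank_self, add_comm]

omit [Fintype F] in
lemma flat_eq_flat_iff {E : V ≃ₗ[F] F × A} {W W' : Submodule F A} {a b : A} :
    flat E W a = flat E W' b ↔ W = W' ∧ a - b ∈ W' := by
  constructor
  · intro h
    refine ⟨?_, ?_⟩
    · ext u
      rw [← symm_zero_mem_flat (E := E) (a := a), h, symm_zero_mem_flat]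
    · rw [← symm_one_mem_flat (E := E), ← h, symm_one_mem_flat]
      simp
  · rintro ⟨rfl, h⟩
    ext v
    rw [mem_flat, mem_flat, ← W.add_mem_iff_left (W.smul_mem (E v).1 h)]
    congr! 1
    module

omit [Fintype F] in
lemma exists_eq_flat (E : V ≃ₗ[F] F × A) {K : Submodule F V} {b : A}
    (hb : E.symm (1, b) ∈ K) : ∃ W, K = flat E W b := by
  refine ⟨K.comap (E.symm.toLinearMap ∘ₗ LinearMap.inr F F A), ?_⟩
  ext v
  have hv : E.symm (0, (E v).2 - (E v).1 • b) = v - (E v).1 • E.symm (1, b) := by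
    rw [E.symm_apply_eq]
    ext <;> simp
  simp only [mem_flat, Submodule.mem_comap, LinearMap.comp_apply, LinearEquiv.coe_coe,
    LinearMap.inr_apply, hv]
  exact (K.sub_mem_iff_left (K.smul_mem _ hb)).symm

omit [Fintype F] in
/-- A subspace that is not contained in the hyperplane `p.1 = 0` contains some `(1, b)`. -/
lemma exists_symm_one_mem (E : V ≃ₗ[F] F × A) {K : Submodule F V} {v : V} (hv : v ∈ K)
    (h0 : (E v).1 ≠ 0) : ∃ b, E.symm (1, b) ∈ K := by
  refine ⟨(E v).1⁻¹ • (E v).2, ?_⟩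
  have : E.symm (1, (E v).1⁻¹ • (E v).2) = (E v).1⁻¹ • v := by
    rw [E.symm_apply_eq]
    ext <;> simp [h0]
  rw [this]
  exact K.smul_mem _ hv

omit [Fintype F] in
lemma span_symm_one_injective (E : V ≃ₗ[F] F × A) :
    Function.Injective fun b : A => Submodule.span F {E.symm (1, b)} := by
  intro b c h
  have hb : E.symm (1, b) ∈ Submodule.span F {E.symm (1, c)} := by
    have h' : Submodule.span F {E.symm (1, b)} = Submodule.span F {E.symm (1, c)} := h
    rw [← h']
    exact Submodule.mem_span_singleton_self _
  obtain ⟨t, ht⟩ := Submodule.mem_span_singleton.1 hb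
  rw [← map_smul, E.symm.injective.eq_iff, Prod.smul_mk, Prod.mk.injEq] at ht
  obtain ⟨h1, h2⟩ := ht
  simp only [smul_eq_mul, mul_one] at h1
  rw [← h2, h1, one_smul]

omit [Fintype F] in
/-- Coordinates in which the hyperplane `H` is `p.1 = 0`. -/
lemma exists_hyperplane_coordinates [Module.Finite F V] (H : Submodule F V)
    (hH : finrank F H + 1 = finrank F V) :
    ∃ E : V ≃ₗ[F] F × H, ∀ v, v ∈ H ↔ (E v).1 = 0 := by
  obtain ⟨C, hC⟩ := H.exists_isCompl
  have h1 : finrank F C = finrank F F := by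
    have := Submodule.finrank_add_eq_of_isCompl hC
    rw [finrank_self]
    omega
  let e := LinearEquiv.ofFinrankEq C F h1
  refine ⟨(Submodule.prodEquivOfIsCompl C H hC.symm).symm.trans
    (e.prodCongr (LinearEquiv.refl F H)), fun v => ?_⟩
  simp

end Flats

section AffineSpreads

variable {Hinf : Submodule F (Fin (n + 1) → F)} {E : (Fin (n + 1) → F) ≃ₗ[F] F × Hinf}

omit [Fintype F] in
lemma isAffSub_flat (hE : ∀ v, v ∈ Hinf ↔ (E v).1 = 0) {k : ℕ} {W : Submodule F Hinf}
    (hW : finrank F W = k) (a : Hinf) : IsAffSub k Hinf (flat E W a) := by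
  refine ⟨by rw [finrank_flat, hW], fun h => ?_⟩
  have := (hE _).1 (h (symm_one_mem_flat.2 (by simp : a - a ∈ W)))
  simp at this

omit [Fintype F] in
lemma exists_symm_one_mem_of_not_le (hE : ∀ v, v ∈ Hinf ↔ (E v).1 = 0)
    {K : Submodule F (Fin (n + 1) → F)} (hK : ¬ K ≤ Hinf) : ∃ b, E.symm (1, b) ∈ K := by
  obtain ⟨v, hv, hv'⟩ := SetLike.not_le_iff_exists.1 hK
  exact exists_symm_one_mem E hv fun h => hv' ((hE v).2 h)

omit [Fintype F] in
lemma IsAffSub.exists_eq_flat (hE : ∀ v, v ∈ Hinf ↔ (E v).1 = 0) {k : ℕ}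
    {K : Submodule F (Fin (n + 1) → F)} (hK : IsAffSub k Hinf K) :
    ∃ (W : Submodule F Hinf) (a : Hinf), finrank F W = k ∧ K = flat E W a := by
  obtain ⟨b, hb⟩ := exists_symm_one_mem_of_not_le hE hK.2
  obtain ⟨W, rfl⟩ := _root_.exists_eq_flat E hb
  refine ⟨W, b, ?_, rfl⟩
  have := hK.1
  rw [finrank_flat] at this
  omega

omit [Fintype F] in
lemma isAffPoint_iff (hE : ∀ v, v ∈ Hinf ↔ (E v).1 = 0)
    {P : Submodule F (Fin (n + 1) → F)} :
    IsAffPoint Hinf P ↔ ∃ b, P = Submodule.span F {E.symm (1, b)} := by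
  have hne : ∀ b, E.symm (1, b) ≠ 0 := by
    intro b h
    rw [E.symm_apply_eq, map_zero] at h
    exact one_ne_zero (congrArg Prod.fst h)
  constructor
  · rintro ⟨h1, h2⟩
    obtain ⟨b, hb⟩ := exists_symm_one_mem_of_not_le hE h2
    refine ⟨b, (Submodule.eq_of_le_of_finrank_eq ?_ ?_).symm⟩
    · rwa [Submodule.span_singleton_le_iff_mem]
    · rw [finrank_span_singleton (hne b), h1]
  · rintro ⟨b, rfl⟩
    refine ⟨finrank_span_singleton (hne b), ?_⟩
    rw [Submodule.span_singleton_le_iff_mem, hE]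
    simp

omit [Fintype F] in
/-- A choice of directions that is constant on each of the resulting cosets gives a spread. -/
lemma isSpread_range_flat (hE : ∀ v, v ∈ Hinf ↔ (E v).1 = 0) {k : ℕ}
    (D : Hinf → Submodule F Hinf) (hD : ∀ a, finrank F (D a) = k)
    (hconst : ∀ a b, b - a ∈ D a → D b = D a) :
    IsSpread k Hinf (Set.range fun a => flat E (D a) a) := by
  refine ⟨?_, fun P hP => ?_⟩
  · rintro _ ⟨a, rfl⟩
    exact isAffSub_flat hE (hD a) a
  · obtain ⟨b, rfl⟩ := (isAffPoint_iff hE).1 hP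
    simp only [Submodule.span_singleton_le_iff_mem]
    refine ⟨flat E (D b) b, ⟨⟨b, rfl⟩, symm_one_mem_flat.2 (by simp)⟩, ?_⟩
    rintro _ ⟨⟨a, rfl⟩, h⟩
    rw [symm_one_mem_flat] at h
    have hba := hconst a b h
    refine flat_eq_flat_iff.2 ⟨hba.symm, ?_⟩
    rw [hba, ← neg_sub]
    exact (D a).neg_mem h

open scoped Classical in
lemma sum_indicator_flat [Fintype Hinf] {k : ℕ} (D : Hinf → Submodule F Hinf)
    (hD : ∀ a, finrank F (D a) = k) (hconst : ∀ a b, b - a ∈ D a → D b = D a)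
    (L : Set (Submodule F (Fin (n + 1) → F))) :
    ∑ a, L.indicator (fun _ => (1 : ℝ)) (flat E (D a) a) =
      (Fintype.card F : ℝ) ^ k * (L ∩ Set.range fun a => flat E (D a) a).ncard := by
  have hfin : Finite (Submodule F (Fin (n + 1) → F)) := .of_injective _ SetLike.coe_injective
  set S := L ∩ Set.range fun a => flat E (D a) a with hS
  have h1 : ∑ a, L.indicator (fun _ => (1 : ℝ)) (flat E (D a) a) =
      (Finset.univ.filter fun a => flat E (D a) a ∈ L).card := by
    rw [Finset.card_filter]
    push_cast
    exact Finset.sum_congr rfl fun a _ => by rw [Set.indicator_apply]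
  have hmaps : ∀ a ∈ Finset.univ.filter (fun a => flat E (D a) a ∈ L),
      flat E (D a) a ∈ S.toFinite.toFinset := by
    intro a ha
    rw [Set.Finite.mem_toFinset]
    exact ⟨(Finset.mem_filter.1 ha).2, a, rfl⟩
  have hfib : ∀ K ∈ S.toFinite.toFinset,
      ((Finset.univ.filter fun a => flat E (D a) a ∈ L).filter
        fun a => flat E (D a) a = K).card = Fintype.card F ^ k := by
    intro K hK
    rw [Set.Finite.mem_toFinset] at hK
    obtain ⟨hKL, c, rfl⟩ := hK
    simp only at hKL ⊢
    rw [← hD c, ← card_filter_sub_mem (D c) c]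
    congr 1
    ext a
    simp only [Finset.mem_filter, Finset.mem_univ, true_and]
    constructor
    · rintro ⟨-, h⟩
      exact (flat_eq_flat_iff.1 h).2
    · intro h
      have : flat E (D a) a = flat E (D c) c := flat_eq_flat_iff.2 ⟨hconst c a h, h⟩
      exact ⟨this ▸ hKL, this⟩
  rw [h1, Finset.card_eq_sum_card_fiberwise hmaps, Finset.sum_congr rfl hfib, Finset.sum_const,
    Set.ncard_eq_toFinset_card S, smul_eq_mul]
  push_cast
  ring

omit [Fintype F] in
open scoped Classical in
/-- The affine points of a flat are the coset of its direction. -/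
lemma finsum_mem_affPoint_flat [Fintype Hinf] (hE : ∀ v, v ∈ Hinf ↔ (E v).1 = 0) (w : Hinf → ℝ)
    (W : Submodule F Hinf) (a : Hinf) :
    ∑ᶠ P ∈ {P | IsAffPoint Hinf P ∧ P ≤ flat E W a},
        Function.extend (fun b => Submodule.span F {E.symm (1, b)}) w 0 P =
      ∑ b, if b - a ∈ W then w b else 0 := by
  have hset : {P | IsAffPoint Hinf P ∧ P ≤ flat E W a} =
      (fun b => Submodule.span F {E.symm (1, b)}) '' {b | b - a ∈ W} := by
    ext P
    simp only [Set.mem_ofPred_eq, Set.mem_image]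
    constructor
    · rintro ⟨hP, hle⟩
      obtain ⟨b, rfl⟩ := (isAffPoint_iff hE).1 hP
      rw [Submodule.span_singleton_le_iff_mem, symm_one_mem_flat] at hle
      exact ⟨b, hle, rfl⟩
    · rintro ⟨b, hb, rfl⟩
      refine ⟨(isAffPoint_iff hE).2 ⟨b, rfl⟩, ?_⟩
      rwa [Submodule.span_singleton_le_iff_mem, symm_one_mem_flat]
  rw [hset, finsum_mem_image (span_symm_one_injective E).injOn]
  simp only [(span_symm_one_injective E).extend_apply]
  rw [finsum_mem_def, finsum_eq_sum_of_fintype]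
  refine Finset.sum_congr rfl fun b _ => ?_
  simp [Set.indicator_apply]

end AffineSpreads

theorem statement7 (q k x : ℕ) (hq : IsPrimePow q) (hF : Fintype.card F = q)
    (hk : 1 ≤ k) (hn : 2 * k + 1 ≤ n)
    (Hinf : Submodule F (Fin (n + 1) → F)) (hH : Module.finrank F Hinf = n)
    (L : Set (Submodule F (Fin (n + 1) → F)))
    (hL : ∀ K ∈ L, IsAffSub k Hinf K)
    (hx : ∀ S, IsSpread k Hinf S → (L ∩ S).ncard = x) :
    IsCLAff k Hinf L ∧ (L.ncard : ℚ) = (x : ℚ) * gaussBinom q n k := by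
  classical
  obtain ⟨E, hE⟩ := exists_hyperplane_coordinates Hinf (by rw [hH]; simp)
  let _ : Fintype Hinf := Fintype.ofFinite _
  have hfin : Finite (Submodule F (Fin (n + 1) → F)) := .of_injective _ SetLike.coe_injective
  have hfin' : Finite (Submodule F Hinf) := .of_injective _ SetLike.coe_injective
  set f : Submodule F Hinf → Hinf → ℝ := fun W a =>
    L.indicator (fun _ => (1 : ℝ)) (flat E W a) with hf
  set X : ℝ := (Fintype.card F : ℝ) ^ k * x with hXdef
  have hspread : ∀ D : Hinf → Submodule F Hinf, (∀ a, finrank F (D a) = k) →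
      (∀ a b, b - a ∈ D a → D b = D a) → ∑ a, f (D a) a = X := by
    intro D hD hconst
    rw [hf, sum_indicator_flat D hD hconst L, hx _ (isSpread_range_flat hE D hD hconst)]
  have hparallel : ∀ W : Submodule F Hinf, finrank F W = k → ∑ a, f W a = X := fun W hW =>
    hspread (fun _ => W) (fun _ => hW) fun _ _ _ => rfl
  constructor
  · refine ⟨hL, ?_⟩
    obtain ⟨w, hw⟩ := exists_weight_of_level_sums k (by omega) f X
      (fun W hW a b hab => by
        rw [hf]
        simp only
        rw [flat_eq_flat_iff.2 ⟨rfl, hab⟩])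
      hparallel
      (fun φ W W' hW hW' hφ hφ' t => by
        have hsub : ∀ U ≤ LinearMap.ker φ, ∀ a b, b - a ∈ U → φ b = φ a := by
          intro U hU a b hab
          have := hU hab
          rwa [LinearMap.mem_ker, map_sub, sub_eq_zero] at this
        have h := hspread (fun a => if φ a = t then W' else W)
          (fun a => by
            by_cases ha : φ a = t
            · exact (congrArg (fun U : Submodule F Hinf => finrank F U) (if_pos ha)).trans hW'
            · exact (congrArg (fun U : Submodule F Hinf => finrank F U) (if_neg ha)).trans hW)
          (fun a b hab => by
            have : φ b = φ a := by
              split_ifs at hab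
              · exact hsub W' hφ' a b hab
              · exact hsub W hφ a b hab
            simp only [this])
        rw [← hparallel W hW, ← sub_eq_zero, ← Finset.sum_sub_distrib] at h
        rw [eq_comm, ← sub_eq_zero, ← Finset.sum_sub_distrib, ← h]
        refine Finset.sum_congr rfl fun b _ => ?_
        by_cases hb : φ b = t <;> simp [hb])
    refine ⟨Function.extend (fun b => Submodule.span F {E.symm (1, b)}) w 0, fun K hK => ?_⟩
    obtain ⟨W, a, hW, rfl⟩ := hK.exists_eq_flat hE
    rw [finsum_mem_affPoint_flat hE]
    exact hw W hW a
  · have hclass : ∀ W : Submodule F Hinf, finrank F W = k → (L ∩ Set.range (flat E W)).ncard = x := fun W hW =>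
      hx _ (isSpread_range_flat hE (fun _ => W) (fun _ => hW) fun _ _ _ => rfl)
    let dir : Submodule F (Fin (n + 1) → F) → Submodule F Hinf := fun K =>
      K.comap (E.symm.toLinearMap ∘ₗ LinearMap.inr F F Hinf)
    have hdir : ∀ W a, dir (flat E W a) = W := fun W a => by
      ext u
      exact symm_zero_mem_flat
    have hcount : L.ncard = Nat.card {W : Submodule F Hinf // finrank F W = k} * x := by
      have hmaps : ∀ K ∈ L.toFinite.toFinset,
          dir K ∈ {W : Submodule F Hinf | finrank F W = k}.toFinite.toFinset := by
        intro K hK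
        rw [Set.Finite.mem_toFinset] at hK ⊢
        obtain ⟨W, a, hW, rfl⟩ := (hL K hK).exists_eq_flat hE
        rw [hdir]
        exact hW
      have hfib : ∀ W ∈ {W : Submodule F Hinf | finrank F W = k}.toFinite.toFinset,
          (L.toFinite.toFinset.filter fun K => dir K = W).card = x := by
        intro W hW
        rw [Set.Finite.mem_toFinset] at hW
        rw [← hclass W hW, ← Set.ncard_coe_finset]
        congr 1
        ext K
        simp only [Finset.coe_filter, Set.Finite.mem_toFinset, Set.mem_ofPred_eq, Set.mem_inter_iff,
          Set.mem_range]
        refine and_congr_right fun hK => ?_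
        constructor
        · obtain ⟨W', a, -, rfl⟩ := (hL K hK).exists_eq_flat hE
          rw [hdir]
          rintro rfl
          exact ⟨a, rfl⟩
        · rintro ⟨a, rfl⟩
          exact hdir W a
      rw [Set.ncard_eq_toFinset_card L, Finset.card_eq_sum_card_fiberwise hmaps,
        Finset.sum_congr rfl hfib, Finset.sum_const, smul_eq_mul,
        ← Set.ncard_eq_toFinset_card, ← Nat.card_coe_set_eq]
      rfl
    rw [hcount, Nat.cast_mul, card_subspaces_eq_gaussBinom k (by omega), hF, hH, mul_comm]
end

section
/- Let q be a prime power, F a finite field with q elements, 1 ≤ k ≤ n−1. If 𝓛 is a Cameron–Liebler k-set of AG(n,q), then for every pair of conjugated switching k-sets (R, R′) of AG(n,q) one has |𝓛 ∩ R| = |𝓛 ∩ R′|. -/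
open Module

variable {F : Type} [Field F] [Fintype F] {n : ℕ}

/-- `R` is a partial `k`-spread of `AG(n,q)`: affine `k`-spaces, no two of which
share an affine point. -/
def IsPartialSpread (k : ℕ) (Hinf : Submodule F (Fin (n + 1) → F))
    (R : Set (Submodule F (Fin (n + 1) → F))) : Prop :=
  (∀ K ∈ R, IsAffSub k Hinf K) ∧
  ∀ P K₁ K₂, IsAffPoint Hinf P → K₁ ∈ R → K₂ ∈ R → P ≤ K₁ → P ≤ K₂ → K₁ = K₂

/-- `(R, R')` is a pair of conjugated switching `k`-sets of `AG(n,q)`. -/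
def IsConjSwitching (k : ℕ) (Hinf : Submodule F (Fin (n + 1) → F))
    (R R' : Set (Submodule F (Fin (n + 1) → F))) : Prop :=
  IsPartialSpread k Hinf R ∧ IsPartialSpread k Hinf R' ∧ Disjoint R R' ∧
  {P | IsAffPoint Hinf P ∧ ∃ K ∈ R, P ≤ K}
    = {P | IsAffPoint Hinf P ∧ ∃ K ∈ R', P ≤ K}

/-- For a partial spread `R` and a Cameron–Liebler weight `w` for `L`, the size of `L ∩ R` is the
total weight of the affine points covered by `R`. -/
lemma IsPartialSpread.ncard_inter_eq_finsum {k : ℕ} {Hinf : Submodule F (Fin (n + 1) → F)}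
    {L R : Set (Submodule F (Fin (n + 1) → F))} (hR : IsPartialSpread k Hinf R)
    {w : Submodule F (Fin (n + 1) → F) → ℝ}
    (hw : ∀ K, IsAffSub k Hinf K → Set.indicator L (fun _ => (1 : ℝ)) K =
      ∑ᶠ P ∈ {P | IsAffPoint Hinf P ∧ P ≤ K}, w P) :
    ((L ∩ R).ncard : ℝ) = ∑ᶠ P ∈ {P | IsAffPoint Hinf P ∧ ∃ K ∈ R, P ≤ K}, w P := by
  have : Finite (Submodule F (Fin (n + 1) → F)) :=
    Finite.of_injective _ SetLike.coe_injective
  have hcover : {P | IsAffPoint Hinf P ∧ ∃ K ∈ R, P ≤ K} =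
      ⋃ K ∈ R, {P | IsAffPoint Hinf P ∧ P ≤ K} := by
    ext P
    simp only [Set.mem_ofPred_eq, Set.mem_iUnion, exists_prop]
    tauto
  have hdisj : R.PairwiseDisjoint fun K => {P | IsAffPoint Hinf P ∧ P ≤ K} :=
    fun K₁ h₁ K₂ h₂ hne => Set.disjoint_left.mpr fun P hP₁ hP₂ =>
      hne (hR.2 P K₁ K₂ hP₁.1 h₁ h₂ hP₁.2 hP₂.2)
  rw [hcover, finsum_mem_biUnion hdisj (Set.toFinite _) fun _ _ => Set.toFinite _,
    ← finsum_mem_congr rfl fun K hK => hw K (hR.1 K hK), finsum_mem_def, Set.indicator_indicator,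
    Set.inter_comm, ← finsum_mem_def, finsum_mem_eq_finite_toFinset_sum _ (Set.toFinite _),
    Finset.sum_const, nsmul_one, Set.ncard_eq_toFinset_card _ (Set.toFinite _)]

theorem statement8 (q k : ℕ) (hq : IsPrimePow q) (hF : Fintype.card F = q)
    (hk : 1 ≤ k) (hkn : k ≤ n - 1)
    (Hinf : Submodule F (Fin (n + 1) → F)) (hH : Module.finrank F Hinf = n)
    (L : Set (Submodule F (Fin (n + 1) → F)))
    (hL : IsCLAff k Hinf L)
    (R R' : Set (Submodule F (Fin (n + 1) → F)))
    (hRR' : IsConjSwitching k Hinf R R') :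
    (L ∩ R).ncard = (L ∩ R').ncard := by
  obtain ⟨-, w, hw⟩ := hL
  obtain ⟨hR, hR', -, hcover⟩ := hRR'
  have h : ((L ∩ R).ncard : ℝ) = (L ∩ R').ncard := by
    rw [hR.ncard_inter_eq_finsum hw, hR'.ncard_inter_eq_finsum hw, hcover]
  exact_mod_cast h
end

section
/- Let q be a prime power, F a finite field with q elements, 1 ≤ k ≤ n−1. Let 𝓛 be a set of affine k-spaces such that for some natural number x, |𝓛 ∩ S| = x for every k-spread S of AG(n,q). Let T be a projective i-space with ¬(T ≤ H∞), where i ≥ max{k+1, 3}; call a k-spread of T a set of affine k-spaces contained in T such that every affine point P with P ≤ T is incident with exactly one of them. Then there exists a natural number c such that |{K ∈ 𝓛 : K ≤ T} ∩ S′| = c for every k-spread S′ of T. -/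
open Module

variable {F : Type} [Field F] [Fintype F] {n : ℕ}

/-- Every submodule contains a submodule of each smaller rank. -/
theorem exists_le_finrank_eq {k : ℕ} (W : Submodule F (Fin (n + 1) → F))
    (h : k ≤ finrank F W) : ∃ D ≤ W, finrank F D = k := by
  obtain ⟨s, hs, hli⟩ := exists_finset_linearIndependent_of_le_finrank h
  refine ⟨(Submodule.span F (s : Set W)).map W.subtype, Submodule.map_subtype_le _ _, ?_⟩
  rw [Submodule.finrank_map_subtype_eq]
  rw [finrank_span_finset_eq_card hli, hs]

/-- The join of a `k`-dimensional direction at infinity with an affine point is an affine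
`k`-space. -/
theorem IsAffPoint.isAffSub_sup {k : ℕ} {Hinf D P : Submodule F (Fin (n + 1) → F)}
    (hP : IsAffPoint Hinf P) (hD : finrank F D = k) (hDH : D ≤ Hinf) :
    IsAffSub k Hinf (D ⊔ P) := by
  refine ⟨?_, fun h => hP.2 (le_sup_right.trans h)⟩
  have hlt : D ⊓ P < P := inf_le_right.lt_of_not_ge fun h => hP.2 ((le_inf_iff.1 h).1.trans hDH)
  have h1 := Submodule.finrank_lt_finrank_of_lt hlt
  have h2 := Submodule.finrank_sup_add_finrank_inf_eq D P
  have h3 := hP.1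
  omega

/-- An affine `k`-space is the join of its direction with any of its affine points. -/
theorem IsAffPoint.sup_eq {k : ℕ} {Hinf D P K : Submodule F (Fin (n + 1) → F)}
    (hP : IsAffPoint Hinf P) (hD : finrank F D = k) (hDH : D ≤ Hinf)
    (hK : IsAffSub k Hinf K) (hDK : D ≤ K) (hPK : P ≤ K) : D ⊔ P = K :=
  Submodule.eq_of_le_of_finrank_eq (sup_le hDK hPK)
    ((hP.isAffSub_sup hD hDH).1.trans hK.1.symm)

/-- A `k`-spread of `T` together with the affine `k`-spaces not in `T` having a fixed direction
`D ≤ T` at infinity is a `k`-spread of the whole space. -/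
theorem isSpread_union_translates {k : ℕ} {Hinf D T : Submodule F (Fin (n + 1) → F)}
    {S : Set (Submodule F (Fin (n + 1) → F))}
    (hD : finrank F D = k) (hDH : D ≤ Hinf) (hDT : D ≤ T)
    (hS : ∀ K ∈ S, IsAffSub k Hinf K ∧ K ≤ T)
    (hST : ∀ P, IsAffPoint Hinf P → P ≤ T → ∃! K, K ∈ S ∧ P ≤ K) :
    IsSpread k Hinf (S ∪ {K | IsAffSub k Hinf K ∧ D ≤ K ∧ ¬ K ≤ T}) := by
  refine ⟨fun K hK => hK.elim (fun h => (hS K h).1) (fun h => h.1), fun P hP => ?_⟩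
  by_cases hPT : P ≤ T
  · obtain ⟨K, hK, huniq⟩ := hST P hP hPT
    refine ⟨K, ⟨Or.inl hK.1, hK.2⟩, ?_⟩
    rintro K' ⟨hK' | hK', hPK'⟩
    · exact huniq K' ⟨hK', hPK'⟩
    · exact absurd ((hP.sup_eq hD hDH hK'.1 hK'.2.1 hPK').ge.trans (sup_le hDT hPT)) hK'.2.2
  · refine ⟨D ⊔ P, ⟨Or.inr ⟨hP.isAffSub_sup hD hDH, le_sup_left,
      fun h => hPT (le_sup_right.trans h)⟩, le_sup_right⟩, ?_⟩
    rintro K' ⟨hK' | hK', hPK'⟩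
    · exact absurd (hPK'.trans (hS K' hK').2) hPT
    · exact (hP.sup_eq hD hDH hK'.1 hK'.2.1 hPK').symm

theorem statement9 (q k i x : ℕ) (hq : IsPrimePow q) (hF : Fintype.card F = q)
    (hk : 1 ≤ k) (hkn : k ≤ n - 1) (hik : k + 1 ≤ i) (hi3 : 3 ≤ i)
    (Hinf : Submodule F (Fin (n + 1) → F)) (hH : Module.finrank F Hinf = n)
    (L : Set (Submodule F (Fin (n + 1) → F)))
    (hL : ∀ K ∈ L, IsAffSub k Hinf K)
    (hx : ∀ S, IsSpread k Hinf S → (L ∩ S).ncard = x)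
    (T : Submodule F (Fin (n + 1) → F))
    (hT : Module.finrank F T = i + 1) (hT2 : ¬ T ≤ Hinf) :
    ∃ c : ℕ, ∀ S' : Set (Submodule F (Fin (n + 1) → F)),
      ((∀ K ∈ S', IsAffSub k Hinf K ∧ K ≤ T) ∧
        ∀ P, IsAffPoint Hinf P → P ≤ T → ∃! K, K ∈ S' ∧ P ≤ K) →
      ({K ∈ L | K ≤ T} ∩ S').ncard = c := by
  have hTH : i ≤ finrank F (Hinf ⊓ T : Submodule F (Fin (n + 1) → F)) := by
    have h1 := Submodule.finrank_sup_add_finrank_inf_eq Hinf T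
    have h2 := Submodule.finrank_le (Hinf ⊔ T)
    rw [finrank_fin_fun] at h2
    omega
  obtain ⟨D, hDle, hD⟩ := exists_le_finrank_eq (Hinf ⊓ T) (by omega : k ≤ _)
  have hDH : D ≤ Hinf := hDle.trans inf_le_left
  have hDT : D ≤ T := hDle.trans inf_le_right
  let U : Set (Submodule F (Fin (n + 1) → F)) :=
    {K | IsAffSub k Hinf K ∧ D ≤ K ∧ ¬ K ≤ T}
  refine ⟨x - (L ∩ U).ncard, fun S' hS' => ?_⟩
  have hspread := isSpread_union_translates hD hDH hDT hS'.1 hS'.2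
  have hdisj : Disjoint (L ∩ S') (L ∩ U) :=
    Set.disjoint_left.2 fun K h1 h2 => h2.2.2.2 (hS'.1 K h1.2).2
  have hcard := hx _ hspread
  rw [Set.inter_union_distrib_left, Set.ncard_union_eq hdisj] at hcard
  have hset : {K ∈ L | K ≤ T} ∩ S' = L ∩ S' := by
    ext K
    exact ⟨fun h => ⟨h.1.1, h.2⟩, fun h => ⟨⟨h.1, (hS'.1 K h.2).2⟩, h.2⟩⟩
  rw [hset]
  omega
end

section
/- Let q be a prime power, F a finite field with q elements, 1 ≤ k ≤ n−1, and let π be an affine (n−1)-space (i.e. a projective (n−1)-space with ¬(π ≤ H∞)). If 𝓛 is a Cameron–Liebler k-set of AG(n,q) with K ≤ π for every K ∈ 𝓛, then 𝓛 = ∅. -/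
open Module

variable {F : Type} [Field F] [Fintype F] {n : ℕ}

/-- A subspace `A` of `B` extends to a subspace of `B` of any intermediate rank. -/
theorem exists_finrank_eq_between {E V : Type*} [Field E] [AddCommGroup V] [Module E V]
    [Module.Finite E V] {A B : Submodule E V} (hAB : A ≤ B) {k : ℕ}
    (hk : finrank E A ≤ k) (hkB : k ≤ finrank E B) :
    ∃ D, A ≤ D ∧ D ≤ B ∧ finrank E D = k := by
  induction k, hk using Nat.le_induction with
  | base => exact ⟨A, le_rfl, hAB, rfl⟩
  | succ k _ ih =>
    obtain ⟨D, hAD, hDB, hD⟩ := ih (by omega)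
    have hlt : ¬ B ≤ D := fun h => by
      have := Submodule.finrank_mono h
      omega
    obtain ⟨v, hvB, hvD⟩ := SetLike.not_le_iff_exists.mp hlt
    refine ⟨D ⊔ E ∙ v, hAD.trans le_sup_left,
      sup_le hDB ((Submodule.span_singleton_le_iff_mem v B).mpr hvB), ?_⟩
    rw [Submodule.finrank_sup_span_singleton hvD, hD]

/-- The rank of the join of a subspace at infinity with an affine point. -/
theorem IsAffPoint.finrank_sup {H P D : Submodule F (Fin (n + 1) → F)} (hP : IsAffPoint H P)
    (hD : D ≤ H) : finrank F ↥(D ⊔ P) = finrank F D + 1 := by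
  have hatom : IsAtom P := Submodule.isAtom_iff_finrank_eq_one.mpr hP.1
  have hinf : D ⊓ P = ⊥ := by
    rw [inf_comm]
    exact (hatom.not_le_iff_disjoint.mp fun h => hP.2 (h.trans hD)).eq_bot
  have h := Submodule.finrank_sup_add_finrank_inf_eq D P
  rw [hinf, finrank_bot, hP.1] at h
  simpa using h

/-- The affine `k`-spaces with a given `k`-dimensional direction `D` partition the affine points. -/
theorem finsum_affSub_of_direction {k : ℕ} {H D : Submodule F (Fin (n + 1) → F)} (hDH : D ≤ H)
    (hD : finrank F D = k) (w : Submodule F (Fin (n + 1) → F) → ℝ) :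
    ∑ᶠ K ∈ {K | IsAffSub k H K ∧ D ≤ K}, ∑ᶠ P ∈ {P | IsAffPoint H P ∧ P ≤ K}, w P =
      ∑ᶠ P ∈ {P | IsAffPoint H P}, w P := by
  have key : ∀ P K, IsAffPoint H P → IsAffSub k H K → D ≤ K → P ≤ K → D ⊔ P = K := by
    intro P K hP hK hDK hPK
    refine Submodule.eq_of_le_of_finrank_eq (sup_le hDK hPK) ?_
    rw [hP.finrank_sup hDH, hD, hK.1]
  rw [← finsum_mem_biUnion (t := fun K => {P | IsAffPoint H P ∧ P ≤ K}) ?_ (Set.toFinite _)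
    (fun _ _ => Set.toFinite _)]
  · congr! 3 with P
    simp only [Set.mem_iUnion, Set.mem_ofPred_eq, exists_prop]
    constructor
    · rintro ⟨K, -, hP, -⟩
      exact hP
    · intro hP
      exact ⟨D ⊔ P, ⟨⟨by rw [hP.finrank_sup hDH, hD], fun h => hP.2 (le_sup_right.trans h)⟩,
        le_sup_left⟩, hP, le_sup_right⟩
  · rintro K₁ ⟨hK₁, hDK₁⟩ K₂ ⟨hK₂, hDK₂⟩ hne
    refine Set.disjoint_left.mpr ?_
    rintro P ⟨hP, hPK₁⟩ ⟨-, hPK₂⟩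
    exact hne ((key P K₁ hP hK₁ hDK₁ hPK₁).symm.trans (key P K₂ hP hK₂ hDK₂ hPK₂))

theorem statement10 (q k : ℕ) (hq : IsPrimePow q) (hF : Fintype.card F = q)
    (hk : 1 ≤ k) (hkn : k ≤ n - 1)
    (Hinf : Submodule F (Fin (n + 1) → F)) (hH : Module.finrank F Hinf = n)
    (π : Submodule F (Fin (n + 1) → F))
    (hπ : Module.finrank F π = n) (hπ2 : ¬ π ≤ Hinf)
    (L : Set (Submodule F (Fin (n + 1) → F)))
    (hL : IsCLAff k Hinf L) (hsub : ∀ K ∈ L, K ≤ π) :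
    L = ∅ := by
  obtain ⟨hLaff, w, hw⟩ := hL
  have hsum : ∀ D ≤ Hinf, finrank F D = k →
      ∑ᶠ K ∈ {K | IsAffSub k Hinf K ∧ D ≤ K}, L.indicator (fun _ => (1 : ℝ)) K =
        ∑ᶠ P ∈ {P | IsAffPoint Hinf P}, w P := by
    intro D hDH hD
    rw [← finsum_affSub_of_direction hDH hD w]
    exact finsum_mem_congr rfl fun K hK => hw K hK.1
  have hnot : ¬ Hinf ≤ π := fun h =>
    hπ2 (Submodule.eq_of_le_of_finrank_eq h (hH.trans hπ.symm)).ge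
  obtain ⟨v, hvH, hvπ⟩ := SetLike.not_le_iff_exists.mp hnot
  have hv0 : v ≠ 0 := fun h => hvπ (h ▸ π.zero_mem)
  obtain ⟨D₀, hvD₀, hD₀H, hD₀⟩ := exists_finrank_eq_between
    ((Submodule.span_singleton_le_iff_mem v Hinf).mpr hvH) (k := k)
    (by rw [finrank_span_singleton hv0]; exact hk) (by omega)
  have hzero : ∑ᶠ P ∈ {P | IsAffPoint Hinf P}, w P = 0 := by
    rw [← hsum D₀ hD₀H hD₀]
    refine finsum_mem_eq_zero_of_forall_eq_zero fun K hK => Set.indicator_of_notMem (fun hKL => ?_) _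
    exact hvπ (hsub K hKL (hK.2 (hvD₀ (Submodule.mem_span_singleton_self v))))
  refine Set.eq_empty_of_forall_notMem fun K hKL => ?_
  have hK := hLaff K hKL
  obtain ⟨D, -, hDle, hD⟩ := exists_finrank_eq_between (bot_le : ⊥ ≤ K ⊓ Hinf) (k := k)
    (by simp) (by
      have h₁ := Submodule.finrank_sup_add_finrank_inf_eq K Hinf
      have h₂ := Submodule.finrank_le (K ⊔ Hinf)
      rw [finrank_fin_fun] at h₂
      have h₃ := hK.1
      omega)
  have h := hsum D (hDle.trans inf_le_right) hD
  rw [hzero, finsum_mem_eq_finite_toFinset_sum _ (Set.toFinite _),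
    Finset.sum_eq_zero_iff_of_nonneg fun K _ => Set.indicator_nonneg (fun _ _ => zero_le_one) K] at h
  have hK0 := h K (by simpa using ⟨hK, hDle.trans inf_le_left⟩)
  rw [Set.indicator_of_mem hKL] at hK0
  exact one_ne_zero hK0
end

section
/- Let q be a prime power, F a finite field with q elements, 1 ≤ k ≤ n−1, and let 𝓛 be a Cameron–Liebler k-set of AG(n,q). Let I ≤ H∞ be a submodule with finrank I = i+1 for some integer −1 ≤ i ≤ k−2 (so I may be the zero submodule when i = −1). Then |{K ∈ 𝓛 : I ≤ K}| · [n k]_q = [n−i−1 k−i−1]_q · |𝓛|; equivalently, if 𝓛 has parameter x then exactly [n−i−1 k−i−1]_q · x members of 𝓛 contain I. -/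
open Module

variable {F : Type} [Field F] [Fintype F] {n : ℕ}

/-- The number of rank `b` subspaces of `V`, multiplied by the number of ordered bases of each,
is the number of linearly independent `b`-tuples. -/
theorem card_finrank_eq_mul (V : Type*) [AddCommGroup V] [Module F V] [Finite V] (b : ℕ)
    (hb : b ≤ finrank F V) :
    Nat.card {W : Submodule F V // finrank F W = b} *
        ∏ i : Fin b, (Fintype.card F ^ b - Fintype.card F ^ (i : ℕ))
      = ∏ i : Fin b, (Fintype.card F ^ finrank F V - Fintype.card F ^ (i : ℕ)) := by
  classical
  have : Fintype V := Fintype.ofFinite V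
  have : Module.Finite F V := Module.Finite.of_finite
  let span : {s : Fin b → V // LinearIndependent F s} → {W : Submodule F V // finrank F W = b} :=
    fun s => ⟨Submodule.span F (Set.range s.1), by
      simpa using finrank_span_eq_card s.2⟩
  have fiber (W : {W : Submodule F V // finrank F W = b}) :
      Nat.card {s // span s = W} =
        ∏ i : Fin b, (Fintype.card F ^ b - Fintype.card F ^ (i : ℕ)) := by
    have key := card_linearIndependent (K := F) (V := W.1) (k := b) W.2.ge
    rw [W.2] at key
    rw [← key]
    refine Nat.card_congr
      { toFun := fun s => ⟨fun i => ⟨s.1.1 i, ?_⟩, ?_⟩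
        invFun := fun t => ⟨⟨fun i => (t.1 i : V), ?_⟩, ?_⟩
        left_inv := fun s => rfl
        right_inv := fun t => rfl }
    · have h : Submodule.span F (Set.range s.1.1) = W.1 := congrArg Subtype.val s.2
      exact h ▸ Submodule.subset_span ⟨i, rfl⟩
    · exact LinearIndependent.of_comp W.1.subtype s.1.2
    · exact t.2.map' W.1.subtype (Submodule.ker_subtype _)
    · refine Subtype.ext (Submodule.eq_of_le_of_finrank_eq ?_ ?_)
      · rw [Submodule.span_le]
        rintro _ ⟨i, rfl⟩
        exact (t.1 i).2
      · exact (span ⟨fun i => (t.1 i : V), _⟩).2.trans W.2.symm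
  rw [← card_linearIndependent hb, ← Nat.card_congr (Equiv.sigmaFiberEquiv span), Nat.card_sigma,
    Finset.sum_congr rfl fun W _ => fiber W, Finset.sum_const, Finset.card_univ,
    Nat.card_eq_fintype_card, smul_eq_mul]

theorem gaussBinom_pos_s14 {q a b : ℕ} (hq : 1 < q) (hb : b ≤ a) : 0 < gaussBinom q a b := by
  have hq' : (1 : ℚ) < q := by exact_mod_cast hq
  refine Finset.prod_pos fun i hi => div_pos ?_ ?_ <;> rw [sub_pos] <;>
    refine one_lt_pow₀ hq' ?_
  · have := Finset.mem_range.1 hi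
    omega
  · omega

theorem prod_pow_sub_pow (q a b : ℕ) (hq : 1 ≤ q) (hb : b ≤ a) :
    ((∏ i : Fin b, (q ^ a - q ^ (i : ℕ)) : ℕ) : ℚ)
      = (∏ i ∈ Finset.range b, (q : ℚ) ^ i) *
        ∏ i ∈ Finset.range b, ((q : ℚ) ^ (a - i) - 1) := by
  rw [Fin.prod_univ_eq_prod_range (fun i => q ^ a - q ^ i), ← Finset.prod_mul_distrib,
    Nat.cast_prod]
  refine Finset.prod_congr rfl fun i hi => ?_
  have hi : i ≤ a := (Finset.mem_range.1 hi).le.trans hb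
  rw [Nat.cast_sub (Nat.pow_le_pow_right hq hi), mul_sub, mul_one, ← pow_add,
    Nat.add_sub_cancel' hi, Nat.cast_pow, Nat.cast_pow]

/-- The Gaussian binomial coefficient counts subspaces of a given rank. -/
theorem card_finrank_eq (V : Type*) [AddCommGroup V] [Module F V] [Finite V] (b : ℕ)
    (hb : b ≤ finrank F V) :
    (Nat.card {W : Submodule F V // finrank F W = b} : ℚ)
      = gaussBinom (Fintype.card F) (finrank F V) b := by
  have hq : 1 < Fintype.card F := Fintype.one_lt_card
  have hq' : (1 : ℚ) < Fintype.card F := by exact_mod_cast hq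
  have h := congrArg (Nat.cast : ℕ → ℚ) (card_finrank_eq_mul (F := F) V b hb)
  rw [Nat.cast_mul, prod_pow_sub_pow _ _ _ hq.le hb, prod_pow_sub_pow _ _ _ hq.le le_rfl] at h
  have hpow : (∏ i ∈ Finset.range b, (Fintype.card F : ℚ) ^ i) ≠ 0 :=
    Finset.prod_ne_zero_iff.2 fun i _ => (pow_pos (by linarith) i).ne'
  have hrefl : ∏ i ∈ Finset.range b, ((Fintype.card F : ℚ) ^ (b - i) - 1)
      = ∏ i ∈ Finset.range b, ((Fintype.card F : ℚ) ^ (i + 1) - 1) := by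
    rw [← Finset.prod_range_reflect]
    refine Finset.prod_congr rfl fun i hi => ?_
    have := Finset.mem_range.1 hi
    congr 2
    omega
  have hden : ∏ i ∈ Finset.range b, ((Fintype.card F : ℚ) ^ (i + 1) - 1) ≠ 0 :=
    Finset.prod_ne_zero_iff.2 fun i _ => (sub_pos.2 (one_lt_pow₀ hq' i.succ_ne_zero)).ne'
  rw [hrefl, mul_left_comm] at h
  rw [gaussBinom, Finset.prod_div_distrib, eq_div_iff hden]
  exact mul_left_cancel₀ hpow h

/-- The Gaussian binomial coefficient counts subspaces of a given rank above a fixed subspace. -/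
theorem card_le_finrank_eq (V : Type*) [AddCommGroup V] [Module F V] [Finite V]
    (U : Submodule F V) (b : ℕ) (hU : finrank F U ≤ b) (hb : b ≤ finrank F V) :
    (Nat.card {W : Submodule F V // U ≤ W ∧ finrank F W = b} : ℚ)
      = gaussBinom (Fintype.card F) (finrank F V - finrank F U) (b - finrank F U) := by
  have : Module.Finite F V := Module.Finite.of_finite
  have hquot : finrank F (V ⧸ U) = finrank F V - finrank F U := by
    have := U.finrank_quotient_add_finrank
    omega
  have hcomap (W : Submodule F (V ⧸ U)) :
      finrank F (W.comap U.mkQ) = finrank F W + finrank F U := by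
    have h1 := (U.mkQ.domRestrict (W.comap U.mkQ)).finrank_range_add_finrank_ker
    have h2 : LinearMap.range (U.mkQ.domRestrict (W.comap U.mkQ)) = W := by
      rw [LinearMap.range_domRestrict, Submodule.map_comap_eq_of_surjective U.mkQ_surjective]
    have h3 : LinearMap.ker (U.mkQ.domRestrict (W.comap U.mkQ))
        = U.submoduleOf (W.comap U.mkQ) := by
      rw [LinearMap.ker_domRestrict, Submodule.ker_mkQ]
      rfl
    rw [h2, h3, (Submodule.submoduleOfEquivOfLe (Submodule.le_comap_mkQ U W)).finrank_eq] at h1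
    exact h1.symm
  have : Finite (V ⧸ U) := Module.finite_of_finite F
  rw [← hquot, ← card_finrank_eq (F := F) (V ⧸ U) _ (by omega)]
  congr 1
  refine Nat.card_congr ((Equiv.subtypeEquiv (Submodule.comapMkQRelIso U).toEquiv
    fun W => ?_).trans (Equiv.subtypeSubtypeEquivSubtypeInter (fun W => U ≤ W)
      fun W => finrank F W = b)).symm
  change _ ↔ finrank F (W.comap U.mkQ) = b
  rw [hcomap]
  omega

theorem finrank_sup_affPoint {Hinf I P : Submodule F (Fin (n + 1) → F)} (hI : I ≤ Hinf)
    (hP : IsAffPoint Hinf P) : finrank F (I ⊔ P : Submodule F _) = finrank F I + 1 := by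
  have hdisj : I ⊓ P = ⊥ := by
    have hatom := (Submodule.isAtom_iff_finrank_eq_one (K := F)).2 hP.1
    refine (hatom.le_iff.1 inf_le_right).resolve_right fun h => hP.2 ?_
    exact (inf_eq_right.1 h).trans hI
  have := Submodule.finrank_sup_add_finrank_inf_eq I P
  rwa [hdisj, finrank_bot, add_zero, hP.1] at this

/-- The number of members of a Cameron–Liebler set through a subspace at infinity is governed by
the total weight of the affine points. -/
theorem IsCLAff.exists_ncard_eq {k : ℕ} {Hinf : Submodule F (Fin (n + 1) → F)}
    {L : Set (Submodule F (Fin (n + 1) → F))} (hL : IsCLAff k Hinf L) (hkn : k ≤ n) :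
    ∃ c : ℝ, ∀ I ≤ Hinf, finrank F I ≤ k →
      (Set.ncard {K ∈ L | I ≤ K} : ℝ)
        = (gaussBinom (Fintype.card F) (n - finrank F I) (k - finrank F I) : ℚ) * c := by
  classical
  obtain ⟨hLaff, w, hw⟩ := hL
  have : Fintype (Submodule F (Fin (n + 1) → F)) := Fintype.ofFinite _
  refine ⟨∑ P with IsAffPoint Hinf P, w P, fun I hI hIk => ?_⟩
  have hcount (P) (hP : IsAffPoint Hinf P) :
      (Finset.card {K | (I ≤ K ∧ IsAffSub k Hinf K) ∧ P ≤ K} : ℝ)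
        = (gaussBinom (Fintype.card F) (n - finrank F I) (k - finrank F I) : ℚ) := by
    have hr := finrank_sup_affPoint hI hP
    have hc := card_le_finrank_eq (F := F) _ (I ⊔ P) (k + 1) (by omega)
      (by rw [finrank_fin_fun]; omega)
    rw [hr, finrank_fin_fun, Nat.add_sub_add_right, Nat.add_sub_add_right,
      Nat.card_eq_fintype_card, Fintype.card_subtype] at hc
    rw [← hc, Rat.cast_natCast]
    refine congrArg (fun s : Finset _ => (s.card : ℝ)) ?_
    ext K
    simp only [Finset.mem_filter, Finset.mem_univ, true_and, sup_le_iff]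
    exact ⟨fun h => ⟨⟨h.1.1, h.2⟩, h.1.2.1⟩,
      fun h => ⟨⟨h.1.1, h.2, fun hK => hP.2 (h.1.2.trans hK)⟩, h.1.2⟩⟩
  calc (Set.ncard {K ∈ L | I ≤ K} : ℝ)
      = ∑ K with I ≤ K ∧ IsAffSub k Hinf K, Set.indicator L (fun _ => (1 : ℝ)) K := by
        rw [Set.ncard_eq_toFinset_card', Finset.cast_card]
        simp only [Set.indicator_apply, ← Finset.sum_filter, Finset.filter_filter]
        refine Finset.sum_congr ?_ fun _ _ => rfl
        ext K
        have := hLaff K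
        simp only [Set.mem_toFinset, Set.mem_ofPred_eq, Finset.mem_filter, Finset.mem_univ,
          true_and]
        tauto
    _ = ∑ K with I ≤ K ∧ IsAffSub k Hinf K, ∑ P with IsAffPoint Hinf P,
          if P ≤ K then w P else 0 := by
        refine Finset.sum_congr rfl fun K hK => ?_
        rw [hw K (Finset.mem_filter.1 hK).2.2, finsum_mem_eq_toFinset_sum, ← Finset.sum_filter,
          Finset.filter_filter]
        refine Finset.sum_congr ?_ fun _ _ => rfl
        ext P
        simp
    _ = _ := by
        rw [Finset.sum_comm, Finset.mul_sum]
        refine Finset.sum_congr rfl fun P hP => ?_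
        rw [← hcount P (Finset.mem_filter.1 hP).2, ← Finset.sum_filter, Finset.filter_filter,
          Finset.sum_const, nsmul_eq_mul]

theorem statement14 (q k j : ℕ) (hq : IsPrimePow q) (hF : Fintype.card F = q)
    (hk : 1 ≤ k) (hkn : k ≤ n - 1) (hj : j + 1 ≤ k)
    (Hinf : Submodule F (Fin (n + 1) → F)) (hH : Module.finrank F Hinf = n)
    (L : Set (Submodule F (Fin (n + 1) → F)))
    (hL : IsCLAff k Hinf L)
    (I : Submodule F (Fin (n + 1) → F))
    (hI : I ≤ Hinf) (hIr : Module.finrank F I = j) :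
    (Set.ncard {K ∈ L | I ≤ K} : ℚ) * gaussBinom q n k
      = gaussBinom q (n - j) (k - j) * (L.ncard : ℚ) ∧
    ∀ x : ℕ, (L.ncard : ℚ) = (x : ℚ) * gaussBinom q n k →
      (Set.ncard {K ∈ L | I ≤ K} : ℚ) = gaussBinom q (n - j) (k - j) * (x : ℚ) := by
  subst hF hIr
  have hG : 0 < gaussBinom (Fintype.card F) n k :=
    gaussBinom_pos_s14 Fintype.one_lt_card (by omega)
  obtain ⟨c, hc⟩ := hL.exists_ncard_eq (by omega)
  have hcI := hc I hI (by omega)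
  have hcL := hc ⊥ bot_le (by simp)
  simp only [bot_le, and_true, Set.ofPred_mem_eq, finrank_bot, Nat.sub_zero] at hcL
  have main : (Set.ncard {K ∈ L | I ≤ K} : ℚ) * gaussBinom (Fintype.card F) n k
      = gaussBinom (Fintype.card F) (n - finrank F I) (k - finrank F I) * (L.ncard : ℚ) := by
    have : (Set.ncard {K ∈ L | I ≤ K} : ℝ) * (gaussBinom (Fintype.card F) n k : ℚ)
        = (gaussBinom (Fintype.card F) (n - finrank F I) (k - finrank F I) : ℚ)
          * (L.ncard : ℝ) := by
      rw [hcI, hcL]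
      ring
    exact_mod_cast this
  refine ⟨main, fun x hx => mul_right_cancel₀ hG.ne' ?_⟩
  rw [main, hx, mul_assoc]
end
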